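/- Let R be a regular local ring of dimension ≥ 2 with residue characteristic 2 and fraction field K. If α, β ∈ K satisfy 1 + α³ = β³, then α ∈ R or 1/α ∈ R, provided R is Henselian (or in general, by passage to the Henselization). -/

import Mathlib

/-- A regular local ring: Noetherian local ring whose maximal ideal is generated by
`dim R` elements. -/
def IsRegularLocal (R : Type*) [CommRing R] [IsLocalRing R] : Prop :=
  IsNoetherianRing R ∧ ∃ s : Finset R, Ideal.span (s : Set R) = IsLocalRing.maximalIdeal R ∧
    (s.card : WithBot (WithTop ℕ)) = ringKrullDim R

open IsLocalRing Polynomial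

universe u

/-- `b` is a non-zero-divisor modulo `a`. -/
def RegularModulo {R : Type*} [CommRing R] (a b : R) : Prop :=
  ∀ r, a ∣ b * r → a ∣ r

theorem eq_bot_of_le_span_singleton_of_notMem {R : Type*} [CommRing R] [IsLocalRing R]
    [IsNoetherianRing R] {x : R} (hx : x ∈ maximalIdeal R) {q : Ideal R} [q.IsPrime]
    (hq : q ≤ Ideal.span {x}) (hxq : x ∉ q) : q = ⊥ := by
  refine Submodule.eq_bot_of_le_smul_of_le_jacobson_bot (Ideal.span {x}) q
    (IsNoetherian.noetherian q) ?_ ?_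
  · intro z hz
    obtain ⟨w, rfl⟩ := Ideal.mem_span_singleton.mp (hq hz)
    rw [smul_eq_mul]
    exact Ideal.mul_mem_mul (Ideal.mem_span_singleton_self x)
      ((Ideal.IsPrime.mem_or_mem ‹_› hz).resolve_left hxq)
  · rw [IsLocalRing.jacobson_eq_maximalIdeal _ bot_ne_top]
    exact (Ideal.span_singleton_le_iff_mem _).mpr hx

theorem isDomain_of_isPrime_span_singleton {R : Type*} [CommRing R] [IsLocalRing R]
    [IsNoetherianRing R] {x : R} (hp : (Ideal.span {x}).IsPrime) (hx : RegularModulo 0 x) :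
    IsDomain R := by
  obtain ⟨q, hq, hqx⟩ := Ideal.exists_minimalPrimes_le (bot_le : (⊥ : Ideal R) ≤ Ideal.span {x})
  have : q.IsPrime := hq.1.1
  have hx' : x ∈ nonZeroDivisors R := by
    rw [mem_nonZeroDivisors_iff_right]
    intro r hr
    exact zero_dvd_iff.mp (hx r (by rw [mul_comm, hr]))
  have hxq : x ∉ q := fun h ↦
    (Ideal.disjoint_nonZeroDivisors_of_mem_minimalPrimes hq).le_bot ⟨h, hx'⟩
  have hxm : x ∈ maximalIdeal R :=
    le_maximalIdeal hp.ne_top (Ideal.mem_span_singleton_self x)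
  have := eq_bot_of_le_span_singleton_of_notMem hxm hqx hxq
  subst this
  exact IsDomain.of_bot_isPrime R

/-- The maximal ideal is generated by a regular sequence of length two. -/
def IsRegularSurface (R : Type*) [CommRing R] [IsLocalRing R] : Prop :=
  ∃ x y : R, Ideal.span {x, y} = maximalIdeal R ∧ RegularModulo 0 x ∧ RegularModulo x y

theorem isLocalRing_quotient_span {R : Type*} [CommRing R] [IsLocalRing R] {x : R}
    (hx : x ∈ maximalIdeal R) : IsLocalRing (R ⧸ Ideal.span {x}) := by
  have : Nontrivial (R ⧸ Ideal.span {x}) := Ideal.Quotient.nontrivial_iff.mpr fun h ↦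
    (Ideal.IsPrime.ne_top (maximalIdeal.isMaximal R).isPrime) <| top_le_iff.mp <|
      h ▸ (Ideal.span_singleton_le_iff_mem _).mpr hx
  exact IsLocalRing.of_surjective' (Ideal.Quotient.mk _) Ideal.Quotient.mk_surjective

theorem isPrime_span_singleton_of_span_pair_eq {R : Type*} [CommRing R] [IsLocalRing R]
    [IsNoetherianRing R] {x y : R} (hm : Ideal.span {x, y} = maximalIdeal R)
    (hxy : RegularModulo x y) :
    (Ideal.span {x}).IsPrime ∧ IsPrincipalIdealRing (R ⧸ Ideal.span {x}) := by
  have hx : x ∈ maximalIdeal R := hm ▸ Ideal.subset_span (by simp)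
  have := isLocalRing_quotient_span hx
  have hmS : Ideal.span {Ideal.Quotient.mk (Ideal.span {x}) y} =
      maximalIdeal (R ⧸ Ideal.span {x}) := by
    rw [← map_maximalIdeal_of_surjective (Ideal.Quotient.mk (Ideal.span {x}))
      Ideal.Quotient.mk_surjective, ← hm, Ideal.map_span, Set.image_pair,
      Ideal.Quotient.eq_zero_iff_mem.mpr (Ideal.mem_span_singleton_self x), Ideal.span_insert_zero]
  have hreg : RegularModulo 0 (Ideal.Quotient.mk (Ideal.span {x}) y) := by
    intro r hr
    obtain ⟨r, rfl⟩ := Ideal.Quotient.mk_surjective r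
    rw [zero_dvd_iff, ← map_mul, Ideal.Quotient.eq_zero_iff_mem, Ideal.mem_span_singleton] at hr
    rw [zero_dvd_iff, Ideal.Quotient.eq_zero_iff_mem, Ideal.mem_span_singleton]
    exact hxy r hr
  have hdom : IsDomain (R ⧸ Ideal.span {x}) :=
    isDomain_of_isPrime_span_singleton (hmS ▸ (maximalIdeal.isMaximal _).isPrime) hreg
  refine ⟨(Ideal.Quotient.isDomain_iff_prime _).mp hdom, ?_⟩
  have hprin : (maximalIdeal (R ⧸ Ideal.span {x})).IsPrincipal := ⟨⟨_, hmS.symm⟩⟩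
  exact ((tfae_of_isNoetherianRing_of_isLocalRing_of_isDomain (R ⧸ Ideal.span {x})).out 4 0).mp
    hprin

namespace IsRegularSurface

theorem isDomain {R : Type*} [CommRing R] [IsLocalRing R] [IsNoetherianRing R]
    (h : IsRegularSurface R) : IsDomain R := by
  obtain ⟨x, y, hm, hx, hxy⟩ := h
  exact isDomain_of_isPrime_span_singleton (isPrime_span_singleton_of_span_pair_eq hm hxy).1 hx

theorem uniqueFactorizationMonoid {R : Type*} [CommRing R] [IsDomain R] [IsLocalRing R]
    [IsNoetherianRing R] (h : IsRegularSurface R) : UniqueFactorizationMonoid R := by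
  obtain ⟨x, y, hm, hx0, hxy⟩ := h
  obtain ⟨hp, hpid⟩ := isPrime_span_singleton_of_span_pair_eq hm hxy
  have hxm : x ∈ maximalIdeal R := hm ▸ Ideal.subset_span (by simp)
  have hxne : x ≠ 0 := by
    rintro rfl
    exact one_ne_zero (zero_dvd_iff.mp (hx0 1 (by simp)))
  rw [UniqueFactorizationMonoid.iff_exists_prime_mem_of_isPrime]
  intro P hP0 hP
  by_cases hxP : x ∈ P
  · exact ⟨x, hxP, (Ideal.span_singleton_prime hxne).mp hp⟩
  obtain ⟨g, hg⟩ := (hpid.principal (P.map (Ideal.Quotient.mk (Ideal.span {x})))).principal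
  have hgP : g ∈ P.map (Ideal.Quotient.mk (Ideal.span {x})) :=
    hg ▸ Submodule.mem_span_singleton_self g
  obtain ⟨f, hfP, rfl⟩ :=
    (Ideal.mem_map_iff_of_surjective _ Ideal.Quotient.mk_surjective).mp hgP
  have hPf : P ≤ Ideal.span {f} := by
    refine Submodule.le_of_le_smul_of_le_jacobson_bot (I := Ideal.span {x})
      (IsNoetherian.noetherian P) ?_ ?_
    · rw [IsLocalRing.jacobson_eq_maximalIdeal _ bot_ne_top]
      exact (Ideal.span_singleton_le_iff_mem _).mpr hxm
    · intro z hz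
      have hz' := Ideal.mem_map_of_mem (Ideal.Quotient.mk (Ideal.span {x})) hz
      rw [hg] at hz'
      obtain ⟨r, hr⟩ := Ideal.mem_span_singleton'.mp hz'
      obtain ⟨r, rfl⟩ := Ideal.Quotient.mk_surjective r
      rw [← map_mul, Ideal.Quotient.eq, Ideal.mem_span_singleton] at hr
      obtain ⟨w, hw⟩ := hr
      have hwP : w ∈ P := by
        refine (hP.mem_or_mem (?_ : x * w ∈ P)).resolve_left hxP
        rw [← hw]
        exact P.sub_mem (P.mul_mem_left _ hfP) hz
      have : z = r * f + x * (-w) := by linear_combination -hw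
      rw [this]
      exact Submodule.add_mem_sup (Ideal.mem_span_singleton'.mpr ⟨r, rfl⟩)
        (Ideal.mul_mem_mul (Ideal.mem_span_singleton_self x) (P.neg_mem hwP))
  have hPeq : P = Ideal.span {f} :=
    le_antisymm hPf ((Ideal.span_singleton_le_iff_mem _).mpr hfP)
  have hf0 : f ≠ 0 := by
    rintro rfl
    exact hP0 (by simpa using hPeq)
  exact ⟨f, hfP, (Ideal.span_singleton_prime hf0).mp (hPeq ▸ hP)⟩

end IsRegularSurface

theorem RegularModulo.map_of_flat {R S : Type*} [CommRing R] [CommRing S] [Algebra R S]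
    [Module.Flat R S] {a b : R} (h : RegularModulo a b) :
    RegularModulo (algebraMap R S a) (algebraMap R S b) := by
  rintro r ⟨s, hs⟩
  obtain ⟨k, c, y, hy, hc⟩ := Module.Flat.isTrivialRelation_of_sum_smul_eq_zero
    (R := R) (M := S) (f := ![b, -a]) (x := ![r, s]) (by simp [Algebra.smul_def, hs])
  have hr : r = ∑ j, c 0 j • y j := by simpa using hy 0
  rw [hr]
  refine Finset.dvd_sum fun j _ ↦ ?_
  have hj := hc j
  simp only [Fin.sum_univ_two, Matrix.cons_val_zero, Matrix.cons_val_one] at hj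
  rw [Algebra.smul_def]
  exact Dvd.dvd.mul_right (_root_.map_dvd _ (h _ ⟨c 1 j, by linear_combination hj⟩)) _

/-- A local homomorphism that behaves like a faithfully flat unramified one. -/
structure IsUnramifiedExtension {R S : Type*} [CommRing R] [IsLocalRing R] [CommRing S]
    [IsLocalRing S] (φ : R →+* S) : Prop where
  map_mem : ∀ r ∈ maximalIdeal R, φ r ∈ maximalIdeal S
  mem_pow_of_map_mem_pow : ∀ n r, φ r ∈ maximalIdeal S ^ n → r ∈ maximalIdeal R ^ n
  regularModulo : ∀ a b, RegularModulo a b → RegularModulo (φ a) (φ b)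

theorem IsUnramifiedExtension.comp {R S T : Type*} [CommRing R] [IsLocalRing R] [CommRing S]
    [IsLocalRing S] [CommRing T] [IsLocalRing T] {φ : R →+* S} {ψ : S →+* T}
    (hψ : IsUnramifiedExtension ψ) (hφ : IsUnramifiedExtension φ) :
    IsUnramifiedExtension (ψ.comp φ) where
  map_mem r hr := hψ.map_mem _ (hφ.map_mem r hr)
  mem_pow_of_map_mem_pow n r hr :=
    hφ.mem_pow_of_map_mem_pow n r (hψ.mem_pow_of_map_mem_pow n _ hr)
  regularModulo a b h := hψ.regularModulo _ _ (hφ.regularModulo a b h)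

theorem AdjoinRoot.formallyUnramified_of_separable {R : Type u} [CommRing R] {f : R[X]}
    (hf : f.Separable) : Algebra.FormallyUnramified R (AdjoinRoot f) := by
  rw [Algebra.FormallyUnramified.iff_comp_injective]
  intro B _ _ I hI g₁ g₂ hg
  apply AdjoinRoot.algHom_ext
  have hroot (g : AdjoinRoot f →ₐ[R] B) : aeval (g (root f)) f = 0 := by
    rw [aeval_algHom_apply, AdjoinRoot.aeval_eq, AdjoinRoot.mk_self, map_zero]
  have hmem : g₂ (root f) - g₁ (root f) ∈ I := by
    rw [← Ideal.Quotient.eq]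
    exact (DFunLike.congr_fun hg (root f)).symm
  have hsq : (g₂ (root f) - g₁ (root f)) ^ 2 = 0 := by
    have := Ideal.pow_mem_pow hmem 2
    rwa [hI] at this
  have htaylor := aeval_add_of_sq_eq_zero f (g₁ (root f)) _ hsq
  rw [add_sub_cancel, hroot, hroot, zero_add] at htaylor
  obtain ⟨p, q, hpq⟩ := hf
  have hpq' := congrArg (aeval (g₁ (root f))) hpq
  rw [map_add, map_mul, map_mul, hroot, map_one, mul_zero, zero_add] at hpq'
  linear_combination (g₂ (root f) - g₁ (root f)) * hpq' + aeval (g₁ (root f)) q * htaylor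

theorem IsRegularSurface.exists_extension_root {R : Type u} [CommRing R] [IsLocalRing R]
    [IsNoetherianRing R] (h : IsRegularSurface R) {f : R[X]} (hmonic : f.Monic)
    (hdeg : 0 < f.natDegree) (hsep : f.Separable) :
    ∃ (S : Type u) (_ : CommRing S) (_ : IsLocalRing S) (_ : IsNoetherianRing S) (φ : R →+* S),
      IsRegularSurface S ∧ IsUnramifiedExtension φ ∧ ∃ s : S, f.eval₂ φ s = 0 := by
  have : Module.Free R (AdjoinRoot f) := hmonic.free_adjoinRoot
  have : Module.Finite R (AdjoinRoot f) := hmonic.finite_adjoinRoot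
  have : Nontrivial (AdjoinRoot f) := by
    have := h.isDomain
    exact AdjoinRoot.nontrivial f (natDegree_pos_iff_degree_pos.mp hdeg).ne'
  have : Algebra.FormallyUnramified R (AdjoinRoot f) :=
    AdjoinRoot.formallyUnramified_of_separable hsep
  have : IsNoetherianRing (AdjoinRoot f) := IsNoetherianRing.of_finite R _
  obtain ⟨n, hn⟩ := Ideal.exists_maximal (AdjoinRoot f)
  have hcomap : n.comap (algebraMap R (AdjoinRoot f)) = maximalIdeal R :=
    eq_maximalIdeal (Ideal.isMaximal_comap_of_isIntegral_of_isMaximal n)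
  let S := Localization.AtPrime n
  have : Module.Flat (AdjoinRoot f) S := IsLocalization.flat S n.primeCompl
  have : Module.Flat R S := Module.Flat.trans R (AdjoinRoot f) S
  have : IsNoetherianRing S := IsLocalization.isNoetherianRing n.primeCompl S inferInstance
  have : Algebra.FormallyUnramified (AdjoinRoot f) S :=
    Algebra.FormallyUnramified.of_isLocalization n.primeCompl
  have : Algebra.FormallyUnramified R S := Algebra.FormallyUnramified.comp R (AdjoinRoot f) S
  have : Algebra.EssFiniteType (AdjoinRoot f) S :=
    Algebra.EssFiniteType.of_isLocalization S n.primeCompl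
  have : Algebra.EssFiniteType R S := Algebra.EssFiniteType.comp R (AdjoinRoot f) S
  have hloc : IsLocalHom (algebraMap R S) := by
    refine ((local_hom_TFAE (algebraMap R S)).out 0 4).mpr ?_
    rw [IsScalarTower.algebraMap_eq R (AdjoinRoot f) S, ← Ideal.comap_comap]
    exact (congrArg _ Localization.AtPrime.under_maximalIdeal).trans hcomap
  have hmap : (maximalIdeal R).map (algebraMap R S) = maximalIdeal S :=
    Algebra.FormallyUnramified.map_maximalIdeal
  have : Module.FaithfullyFlat R S := Module.FaithfullyFlat.of_flat_of_isLocalHom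
  refine ⟨S, inferInstance, inferInstance, inferInstance, algebraMap R S, ?_, ⟨?_, ?_, ?_⟩, ?_⟩
  · obtain ⟨x, y, hm, hx, hxy⟩ := h
    refine ⟨algebraMap R S x, algebraMap R S y, ?_, ?_, hxy.map_of_flat⟩
    · rw [← hmap, ← hm, Ideal.map_span, Set.image_pair]
    · simpa using hx.map_of_flat (S := S)
  · intro r hr
    exact hmap ▸ Ideal.mem_map_of_mem _ hr
  · intro k r hr
    rw [← hmap, ← Ideal.map_pow] at hr
    rwa [← Ideal.mem_comap, Ideal.comap_map_eq_self_of_faithfullyFlat] at hr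
  · intro a b hab
    exact hab.map_of_flat
  · refine ⟨algebraMap (AdjoinRoot f) S (AdjoinRoot.root f), ?_⟩
    rw [IsScalarTower.algebraMap_eq R (AdjoinRoot f) S, ← hom_eval₂]
    have : eval₂ (algebraMap R (AdjoinRoot f)) (AdjoinRoot.root f) f = 0 := AdjoinRoot.eval₂_root f
    rw [this, map_zero]

theorem isUnit_three_map {R S : Type*} [CommRing R] [CommRing S] (φ : R →+* S)
    (h : IsUnit (3 : R)) : IsUnit (3 : S) := by
  have := h.map φ
  rwa [map_ofNat] at this

theorem isRelPrime_of_regularModulo {R : Type*} [CommRing R] [IsDomain R] {a b : R} (ha : a ≠ 0)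
    (h : RegularModulo a b) : IsRelPrime a b := by
  rintro d ⟨a', rfl⟩ ⟨b', rfl⟩
  obtain ⟨t, ht⟩ := h a' ⟨b', by ring⟩
  have ha' : a' ≠ 0 := right_ne_zero_of_mul ha
  refine IsUnit.of_mul_eq_one t (mul_left_cancel₀ ha' ?_)
  linear_combination -ht

theorem IsRelPrime.regularModulo {R : Type*} [CommRing R] [IsDomain R]
    [UniqueFactorizationMonoid R] {a b : R} (h : IsRelPrime a b) : RegularModulo a b :=
  fun _ hr ↦ h.dvd_of_dvd_mul_left hr

theorem exists_unit_mul_cube_of_mul_mul_eq_cube {R : Type*} [CommRing R] [IsDomain R]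
    [UniqueFactorizationMonoid R] {a b c d : R} (hab : IsRelPrime a b) (hac : IsRelPrime a c)
    (h : a * b * c = d ^ 3) : ∃ (u : Rˣ) (x : R), a = u * x ^ 3 := by
  let := UniqueFactorizationMonoid.toGCDMonoid R
  obtain ⟨x, u, hx⟩ := exists_associated_pow_of_mul_eq_pow (a := a) (b := b * c)
    (gcd_isUnit_iff_isRelPrime.mpr (hab.mul_right hac)) (by rw [← mul_assoc, h])
  exact ⟨u, x, by rw [← hx, mul_comm]⟩

/-- Cube roots of finitely many units can be adjoined. -/
theorem IsRegularSurface.exists_extension_cubes {R : Type u} [CommRing R] [IsLocalRing R]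
    [IsNoetherianRing R] (h : IsRegularSurface R) (h3 : IsUnit (3 : R)) (s : List Rˣ) :
    ∃ (S : Type u) (_ : CommRing S) (_ : IsLocalRing S) (_ : IsNoetherianRing S) (φ : R →+* S),
      IsRegularSurface S ∧ IsUnramifiedExtension φ ∧
        ∀ u ∈ s, ∃ v : Sˣ, (v : S) ^ 3 = φ u := by
  induction s with
  | nil =>
    exact ⟨R, _, _, ‹_›, RingHom.id R, h, ⟨fun _ h ↦ h, fun _ _ h ↦ h, fun _ _ h ↦ h⟩, by simp⟩
  | cons u s ih =>
    obtain ⟨S, _, _, _, φ, hS, hφ, hs⟩ := ih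
    have h3S : IsUnit ((3 : ℕ) : S) := by exact_mod_cast isUnit_three_map φ h3
    obtain ⟨T, _, _, _, ψ, hT, hψ, t, ht⟩ := hS.exists_extension_root
      (f := X ^ 3 - C ((Units.map (φ : R →* S) u : Sˣ) : S)) (monic_X_pow_sub_C _ (by norm_num))
      (by rw [natDegree_X_pow_sub_C]; norm_num) (separable_X_pow_sub_C_unit _ h3S)
    have ht' : t ^ 3 = ψ (φ u) := by simpa [sub_eq_zero] using ht
    refine ⟨T, _, _, ‹_›, ψ.comp φ, hT, hψ.comp hφ, ?_⟩
    intro w hw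
    rcases List.mem_cons.mp hw with rfl | hw
    · have : IsUnit t := by
        rw [← isUnit_pow_iff (three_ne_zero), ht']
        exact (w.isUnit.map φ).map ψ
      exact ⟨this.unit, ht'⟩
    · obtain ⟨v, hv⟩ := hs w hw
      exact ⟨Units.map (ψ : S →* T) v, by simp [← map_pow, hv]⟩

theorem IsRegularSurface.exists_extension_omega {R : Type u} [CommRing R] [IsLocalRing R]
    [IsNoetherianRing R] (h : IsRegularSurface R) (h3 : IsUnit (3 : R)) :
    ∃ (S : Type u) (_ : CommRing S) (_ : IsLocalRing S) (_ : IsNoetherianRing S) (φ : R →+* S),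
      IsRegularSurface S ∧ IsUnramifiedExtension φ ∧ ∃ ω : S, ω ^ 2 + ω + 1 = 0 := by
  have hdeg : (X ^ 2 + X + 1 : R[X]).natDegree = 2 := by compute_degree!
  obtain ⟨v, hv⟩ := h3.exists_left_inv
  obtain ⟨S, _, _, _, φ, hS, hφ, s, hs⟩ := h.exists_extension_root (f := X ^ 2 + X + 1)
    (by monicity!) (by omega) ⟨C v * 4, -(C v * (2 * X + 1)), by
      have : C v * 3 = (1 : R[X]) := by
        rw [← C_1, ← hv, C_mul]
        rfl
      simp only [derivative_add, derivative_X_pow, derivative_X, derivative_one]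
      simp only [Nat.cast_ofNat, map_ofNat]
      linear_combination this⟩
  exact ⟨S, _, _, ‹_›, φ, hS, hφ, s, by simpa using hs⟩

theorem cube_mem_pow_of_mem_pow {R : Type*} [CommRing R] {I : Ideal R} {n : ℕ} (hn : 1 ≤ n)
    {x : R} (hx : x ∈ I ^ n) : x ^ 3 ∈ I ^ (n + 1) := by
  have := Ideal.pow_mem_pow hx 3
  rw [← pow_mul] at this
  exact Ideal.pow_le_pow_right (by omega) this

/-- Infinite descent along multiplication by `√-3` on the Fermat cubic. -/
theorem IsRegularSurface.mem_pow_of_cube_add_cube_add_cube_eq_zero (n : ℕ) {R : Type u} [CommRing R]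
    [IsLocalRing R] [IsNoetherianRing R] (h : IsRegularSurface R) (h3 : IsUnit (3 : R)) {ω : R}
    (hω : ω ^ 2 + ω + 1 = 0) {a b c : R} (ha : a ∈ maximalIdeal R) (hb : b ∈ maximalIdeal R)
    (ha0 : a ≠ 0) (hab : RegularModulo a b) (habc : a ^ 3 + b ^ 3 + c ^ 3 = 0) :
    a ∈ maximalIdeal R ^ n ∧ b ∈ maximalIdeal R ^ n := by
  induction n generalizing R with
  | zero => simp
  | succ n ih =>
    rcases Nat.eq_zero_or_pos n with rfl | hn
    · simpa using ⟨ha, hb⟩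
    have := h.isDomain
    have := h.uniqueFactorizationMonoid
    have hrel := isRelPrime_of_regularModulo ha0 hab
    obtain ⟨i, hi⟩ := h3.exists_left_inv
    have hω3 : ω ^ 3 = 1 := by linear_combination (ω - 1) * hω
    have hrel_of (p q : R) (r s t v : R) (h₁ : r * p + s * q = a) (h₂ : t * p + v * q = b) :
        IsRelPrime p q := fun d hp hq ↦ hrel
      (h₁ ▸ dvd_add (hp.mul_left r) (hq.mul_left s)) (h₂ ▸ dvd_add (hp.mul_left t) (hq.mul_left v))
    have h12 : IsRelPrime (a + b) (a + ω * b) := hrel_of _ _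
      (1 - i * (1 - ω ^ 2)) (i * (1 - ω ^ 2)) (i * (1 - ω ^ 2)) (-(i * (1 - ω ^ 2)))
      (by grind) (by grind)
    have h13 : IsRelPrime (a + b) (a + ω ^ 2 * b) := hrel_of _ _
      (1 - i * (1 - ω)) (i * (1 - ω)) (i * (1 - ω)) (-(i * (1 - ω)))
      (by grind) (by grind)
    have h23 : IsRelPrime (a + ω * b) (a + ω ^ 2 * b) := hrel_of _ _
      (1 - i * (1 - ω ^ 2)) (i * (1 - ω ^ 2)) (i * (ω ^ 2 - ω)) (-(i * (ω ^ 2 - ω)))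
      (by grind) (by grind)
    have hprod : (a + b) * (a + ω * b) * (a + ω ^ 2 * b) = (-c) ^ 3 := by grind
    obtain ⟨u, x, hx⟩ := exists_unit_mul_cube_of_mul_mul_eq_cube h12 h13 hprod
    obtain ⟨v, y, hy⟩ := exists_unit_mul_cube_of_mul_mul_eq_cube h12.symm h23
      (d := -c) (by rw [← hprod]; ring)
    obtain ⟨w, z, hz⟩ := exists_unit_mul_cube_of_mul_mul_eq_cube h13.symm h23.symm
      (d := -c) (by rw [← hprod]; ring)
    let o : Rˣ := ⟨ω, ω ^ 2, by grind, by grind⟩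
    obtain ⟨S, _, _, _, φ, hS, hφ, hcubes⟩ := h.exists_extension_cubes h3 [u, o * v, o ^ 2 * w]
    obtain ⟨u', hu'⟩ := hcubes u (by simp)
    obtain ⟨v', hv'⟩ := hcubes (o * v) (by simp)
    obtain ⟨w', hw'⟩ := hcubes (o ^ 2 * w) (by simp)
    have hmem (t : Rˣ) (x p : R) (hp : p ∈ maximalIdeal R) (hx : p = t * x ^ 3) :
        x ∈ maximalIdeal R := by
      rw [hx, Ideal.unit_mul_mem_iff_mem _ t.isUnit] at hp
      exact (maximalIdeal.isMaximal R).isPrime.mem_of_pow_mem _ hp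
    have hxm := hmem u x _ (add_mem ha hb) hx
    have hym := hmem v y _ (add_mem ha (Ideal.mul_mem_left _ _ hb)) hy
    have hx0 : x ≠ 0 := by
      rintro rfl
      have h0 : a + b = 0 := by simpa using hx
      have : IsUnit a := hrel dvd_rfl ⟨-1, by linear_combination h0⟩
      exact ha this
    have hxy : RegularModulo x y := by
      refine IsRelPrime.regularModulo fun d hdx hdy ↦ h12 ?_ ?_
      · rw [hx]
        exact (hdx.pow (three_ne_zero)).mul_left _
      · rw [hy]
        exact (hdy.pow (three_ne_zero)).mul_left _
    have hdomS := hS.isDomain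
    have hunit (t : Sˣ) (k : ℕ) (p : R) (hp : t * φ p ∈ maximalIdeal S ^ k) :
        p ∈ maximalIdeal R ^ k := by
      rw [Ideal.unit_mul_mem_iff_mem _ t.isUnit] at hp
      exact hφ.mem_pow_of_map_mem_pow k p hp
    have hφx0 : φ x ≠ 0 := by
      intro h0
      refine hx0 ?_
      have hbot := Ideal.iInf_pow_eq_bot_of_isLocalRing (maximalIdeal R)
        (maximalIdeal.isMaximal R).ne_top
      rw [← Ideal.mem_bot, ← hbot, Ideal.mem_iInf]
      exact fun k ↦ hφ.mem_pow_of_map_mem_pow k x (h0 ▸ zero_mem _)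
    have hrec := ih (R := S) hS (isUnit_three_map φ h3) (ω := φ ω)
      (by simpa using congrArg φ hω) (a := u' * φ x) (b := v' * φ y) (c := w' * φ z)
      (Ideal.mul_mem_left _ _ (hφ.map_mem x hxm)) (Ideal.mul_mem_left _ _ (hφ.map_mem y hym))
      (mul_ne_zero u'.ne_zero hφx0)
      (by
        intro r hr
        rw [Units.mul_left_dvd] at hr ⊢
        rw [mul_assoc, mul_left_comm] at hr
        exact (Units.dvd_mul_left).mp (hφ.regularModulo x y hxy _ hr))
      (by
        rw [mul_pow, mul_pow, mul_pow, hu', hv', hw', ← map_pow, ← map_pow, ← map_pow, ← map_mul,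
          ← map_mul, ← map_mul, ← map_add, ← map_add, ← map_zero φ]
        congr 1
        simp only [Units.val_mul, Units.val_pow_eq_pow_val, o]
        linear_combination (-1) * hx - ω * hy - ω ^ 2 * hz + (a + b * ω ^ 2 - b * ω + b) * hω)
    have hx' := cube_mem_pow_of_mem_pow hn (hunit _ _ _ hrec.1)
    have hy' := cube_mem_pow_of_mem_pow hn (hunit _ _ _ hrec.2)
    have h1 : a + b ∈ maximalIdeal R ^ (n + 1) := hx ▸ Ideal.mul_mem_left _ _ hx'
    have h2 : a + ω * b ∈ maximalIdeal R ^ (n + 1) := hy ▸ Ideal.mul_mem_left _ _ hy'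
    have hb' : b ∈ maximalIdeal R ^ (n + 1) := by
      have : b = i * (1 - ω ^ 2) * ((a + b) - (a + ω * b)) := by grind
      rw [this]
      exact Ideal.mul_mem_left _ _ (sub_mem h1 h2)
    exact ⟨by simpa using sub_mem h1 hb', hb'⟩

theorem IsRegularSurface.dvd_or_dvd_of_cube_add_cube_eq_cube {R : Type u} [CommRing R]
    [IsLocalRing R] [IsNoetherianRing R] (h : IsRegularSurface R) (h3 : IsUnit (3 : R))
    {a b c : R} (habc : c ^ 3 + a ^ 3 = b ^ 3) : c ∣ a ∨ a ∣ c := by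
  have := h.isDomain
  have := h.uniqueFactorizationMonoid
  by_cases hc0 : c = 0
  · exact Or.inr (hc0 ▸ dvd_zero a)
  let := UniqueFactorizationMonoid.toGCDMonoid R
  obtain ⟨a', c', ha, hc, hu⟩ := extract_gcd a c
  set g := gcd a c
  have hrel : IsRelPrime a' c' := gcd_isUnit_iff_isRelPrime.mp hu
  have hg0 : g ≠ 0 := by
    intro h0
    exact hc0 (by rw [hc, h0, zero_mul])
  have hgb : g ∣ b := by
    rw [← UniqueFactorizationMonoid.pow_dvd_pow_iff_dvd (n := 3) three_ne_zero]
    exact ⟨c' ^ 3 + a' ^ 3, by rw [← habc]; nth_rw 1 [ha, hc]; ring⟩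
  obtain ⟨b', hb⟩ := hgb
  have habc' : c' ^ 3 + a' ^ 3 + (-b') ^ 3 = 0 := by
    have : g ^ 3 * (c' ^ 3 + a' ^ 3 + (-b') ^ 3) = 0 := by
      have : (g * c') ^ 3 + (g * a') ^ 3 = (g * b') ^ 3 := by rw [← ha, ← hb, ← hc, habc]
      linear_combination this
    exact (mul_eq_zero.mp this).resolve_left (pow_ne_zero 3 hg0)
  by_cases hca : IsUnit c'
  · left
    rw [ha, hc]
    exact mul_dvd_mul_left g hca.dvd
  by_cases hau : IsUnit a'
  · right
    rw [ha, hc]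
    exact mul_dvd_mul_left g hau.dvd
  exfalso
  obtain ⟨S, _, _, _, φ, hS, hφ, ω, hω⟩ := h.exists_extension_omega h3
  have hc'0 : c' ≠ 0 := by
    rintro rfl
    exact hc0 (by rw [hc, mul_zero])
  have hbot := Ideal.iInf_pow_eq_bot_of_isLocalRing (maximalIdeal R)
    (maximalIdeal.isMaximal R).ne_top
  have hφc : φ c' ≠ 0 := by
    intro h0
    refine hc'0 ?_
    rw [← Ideal.mem_bot, ← hbot, Ideal.mem_iInf]
    exact fun k ↦ hφ.mem_pow_of_map_mem_pow k c' (h0 ▸ zero_mem _)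
  refine hc'0 ?_
  rw [← Ideal.mem_bot, ← hbot, Ideal.mem_iInf]
  intro k
  refine hφ.mem_pow_of_map_mem_pow k c' ?_
  exact (hS.mem_pow_of_cube_add_cube_add_cube_eq_zero k (isUnit_three_map φ h3) hω
    (hφ.map_mem c' hca) (hφ.map_mem a' hau) hφc (hφ.regularModulo _ _ hrel.symm.regularModulo)
    (c := φ (-b')) (by simpa using congrArg φ habc')).1

theorem exists_mem_maximalIdeal_notMem_sq {R : Type*} [CommRing R] [IsLocalRing R]
    (h : ¬ maximalIdeal R ≤ maximalIdeal R ^ 2) {F : Set (Ideal R)} (hF : F.Finite)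
    (hp : ∀ P ∈ F, P.IsPrime) (hm : ∀ P ∈ F, ¬ maximalIdeal R ≤ P) :
    ∃ x ∈ maximalIdeal R, x ∉ maximalIdeal R ^ 2 ∧ ∀ P ∈ F, x ∉ P := by
  by_contra! hcon
  obtain ⟨P, hP, hle⟩ := (Ideal.subset_union_prime_finite (hF.insert (maximalIdeal R ^ 2))
    (f := id) (I := maximalIdeal R) (maximalIdeal R ^ 2) (maximalIdeal R ^ 2)
    fun P hP hP2 _ ↦ hp P ((Set.mem_insert_iff.mp hP).resolve_left hP2)).mp fun x hx ↦ by
      by_cases hx2 : x ∈ maximalIdeal R ^ 2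
      · exact Set.mem_biUnion (Set.mem_insert _ _) hx2
      · obtain ⟨P, hP, hxP⟩ := hcon x hx hx2
        exact Set.mem_biUnion (Set.mem_insert_of_mem _ hP) hxP
  rcases Set.mem_insert_iff.mp hP with rfl | hP
  · exact h hle
  · exact hm P hP hle

/-- The maximal ideal is not an associated prime of `R ⧸ J`. -/
def HasPositiveDepth {R : Type*} [CommRing R] [IsLocalRing R] (J : Ideal R) : Prop :=
  ∀ z, (∀ y ∈ maximalIdeal R, y * z ∈ J) → z ∈ J

theorem exists_regular_mem_maximalIdeal {R : Type*} [CommRing R] [IsLocalRing R]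
    [IsNoetherianRing R] (h : ¬ maximalIdeal R ≤ maximalIdeal R ^ 2) {L : Set (Ideal R)}
    (hL : L.Finite) (hd : ∀ J ∈ L, HasPositiveDepth J) :
    ∃ x ∈ maximalIdeal R, x ∉ maximalIdeal R ^ 2 ∧ ∀ J ∈ L, ∀ r, x * r ∈ J → r ∈ J := by
  obtain ⟨x, hx, hx2, hxP⟩ := exists_mem_maximalIdeal_notMem_sq h
    (F := ⋃ J ∈ L, associatedPrimes R (R ⧸ J))
    (hL.biUnion fun J _ ↦ associatedPrimes.finite R (R ⧸ J))
    (fun P hP ↦ by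
      obtain ⟨J, _, hP⟩ := Set.mem_iUnion₂.mp hP
      exact IsAssociatedPrime.isPrime hP)
    (fun P hP hle ↦ by
      obtain ⟨J, hJ, hP⟩ := Set.mem_iUnion₂.mp hP
      obtain ⟨hprime, z, hz⟩ := isAssociatedPrime_iff.mp (AssociatedPrimes.mem_iff.mp hP)
      obtain ⟨z, rfl⟩ := Ideal.Quotient.mk_surjective z
      have hzJ : z ∈ J := hd J hJ z fun y hy ↦ by
        have := hle hy
        rw [hz, Submodule.mem_colon_singleton] at this
        rwa [Submodule.mem_bot, Algebra.smul_def, Ideal.Quotient.algebraMap_eq, ← map_mul,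
          Ideal.Quotient.eq_zero_iff_mem] at this
      refine hprime.ne_top ((Ideal.eq_top_iff_one _).mpr ?_)
      rw [hz, Submodule.mem_colon_singleton, Ideal.Quotient.eq_zero_iff_mem.mpr hzJ]
      simp)
  refine ⟨x, hx, hx2, fun J hJ r hr ↦ ?_⟩
  by_contra hrJ
  have : x ∈ ⋃ P ∈ associatedPrimes R (R ⧸ J), (P : Set R) := by
    rw [biUnion_associatedPrimes_eq_zero_divisors]
    refine ⟨Ideal.Quotient.mk J r, by rwa [Ne, Ideal.Quotient.eq_zero_iff_mem], ?_⟩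
    rwa [Algebra.smul_def, Ideal.Quotient.algebraMap_eq, ← map_mul, Ideal.Quotient.eq_zero_iff_mem]
  obtain ⟨P, hP, hxP'⟩ := Set.mem_iUnion₂.mp this
  exact hxP P (Set.mem_biUnion hJ hP) hxP'

/-- A local ring of dimension at least `d` whose maximal ideal has at most `d` generators. -/
def IsRegularOfDim (d : ℕ) (R : Type*) [CommRing R] [IsLocalRing R] : Prop :=
  (∃ s : Finset R, Ideal.span (s : Set R) = maximalIdeal R ∧ s.card ≤ d) ∧ d ≤ ringKrullDim R

theorem IsRegularOfDim.quotient {R : Type*} [CommRing R] [IsLocalRing R] [IsNoetherianRing R]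
    {d : ℕ} (h : IsRegularOfDim (d + 1) R) {x : R} (hx : x ∈ maximalIdeal R)
    (hx2 : x ∉ maximalIdeal R ^ 2) [IsLocalRing (R ⧸ Ideal.span {x})] :
    IsRegularOfDim d (R ⧸ Ideal.span {x}) := by
  classical
  obtain ⟨⟨s, hs, hcard⟩, hdim⟩ := h
  constructor
  · have hxs := hx
    rw [← hs] at hxs
    obtain ⟨f, -, hf⟩ := Submodule.mem_span_finset.mp hxs
    obtain ⟨i, hi, hfi⟩ : ∃ i ∈ s, IsUnit (f i) := by
      by_contra! hcon
      refine hx2 (hf ▸ Ideal.sum_mem _ fun i hi ↦ ?_)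
      rw [pow_two]
      exact Ideal.mul_mem_mul (hcon i hi) (hs ▸ Ideal.subset_span hi)
    refine ⟨(s.erase i).image (Ideal.Quotient.mk _), ?_, ?_⟩
    · rw [← map_maximalIdeal_of_surjective (Ideal.Quotient.mk (Ideal.span {x}))
        Ideal.Quotient.mk_surjective, ← hs, Ideal.map_span]
      refine le_antisymm (Ideal.span_mono ?_) (Ideal.span_le.mpr ?_)
      · rw [Finset.coe_image]
        exact Set.image_mono (Finset.erase_subset i s)
      · rintro _ ⟨j, hj, rfl⟩
        by_cases hji : j = i
        · subst hji
          have h0 : Ideal.Quotient.mk (Ideal.span {x}) (∑ k ∈ s, f k • k) = 0 :=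
            Ideal.Quotient.eq_zero_iff_mem.mpr (hf ▸ Ideal.mem_span_singleton_self x)
          rw [← Finset.add_sum_erase s _ hj, map_add, map_sum] at h0
          simp only [smul_eq_mul, map_mul] at h0
          rw [SetLike.mem_coe, ← Ideal.unit_mul_mem_iff_mem _ (hfi.map (Ideal.Quotient.mk _)),
            eq_neg_of_add_eq_zero_left h0]
          refine neg_mem (Ideal.sum_mem _ fun k hk ↦ Ideal.mul_mem_left _ _ (Ideal.subset_span ?_))
          exact Finset.mem_coe.mpr (Finset.mem_image_of_mem _ hk)
        · exact Ideal.subset_span (Finset.mem_coe.mpr (Finset.mem_image_of_mem _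
            (Finset.mem_erase.mpr ⟨hji, hj⟩)))
    · refine Finset.card_image_le.trans ?_
      rw [Finset.card_erase_of_mem hi]
      omega
  · have := ringKrullDim_le_ringKrullDim_quotient_add_card {x} (by
      simpa [IsLocalRing.ringJacobson_eq_maximalIdeal] using hx)
    rw [Finset.coe_singleton, Finset.card_singleton, Nat.cast_one] at this
    refine ENat.WithBot.add_le_add_one_right_iff.mp (le_trans ?_ this)
    exact_mod_cast hdim

theorem IsRegularOfDim.ringKrullDim_ne_zero {R : Type*} [CommRing R] [IsLocalRing R] {d : ℕ}
    (h : IsRegularOfDim (d + 1) R) : ringKrullDim R ≠ 0 := by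
  intro h0
  have := h.2
  rw [h0] at this
  exact Nat.not_succ_le_zero d (by exact_mod_cast this)

theorem IsRegularOfDim.not_le_sq {R : Type*} [CommRing R] [IsLocalRing R] [IsNoetherianRing R]
    {d : ℕ} (h : IsRegularOfDim (d + 1) R) : ¬ maximalIdeal R ≤ maximalIdeal R ^ 2 := by
  intro hle
  have hbot : maximalIdeal R = ⊥ := by
    refine Submodule.eq_bot_of_le_smul_of_le_jacobson_bot (maximalIdeal R) _
      (IsNoetherian.noetherian _) ?_ (IsLocalRing.jacobson_eq_maximalIdeal _ bot_ne_top).ge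
    rwa [smul_eq_mul, ← pow_two]
  exact h.ringKrullDim_ne_zero
    (ringKrullDim_eq_zero_of_isField (isField_iff_maximalIdeal_eq.mpr hbot))

theorem IsRegularOfDim.isDomain {d : ℕ} {R : Type u} [CommRing R] [IsLocalRing R]
    [IsNoetherianRing R] (h : IsRegularOfDim d R) : IsDomain R := by
  induction d generalizing R with
  | zero =>
    obtain ⟨⟨s, hs, hcard⟩, -⟩ := h
    obtain rfl : s = ∅ := Finset.card_eq_zero.mp (by omega)
    exact (isField_iff_maximalIdeal_eq.mpr (by simpa using hs.symm)).isDomain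
  | succ d ih =>
    obtain ⟨x, hx, hx2, hxP⟩ := exists_mem_maximalIdeal_notMem_sq h.not_le_sq
      (Ideal.finite_minimalPrimes_of_isNoetherianRing R ⊥) (fun P hP ↦ hP.1.1) (by
        intro P hP hle
        have hPm : P = maximalIdeal R := le_antisymm (le_maximalIdeal hP.1.1.ne_top) hle
        subst hPm
        refine h.ringKrullDim_ne_zero ?_
        rw [← maximalIdeal_height_eq_ringKrullDim, Ideal.height_eq_zero_iff.mpr hP]
        rfl)
    have := isLocalRing_quotient_span hx
    have := ih (h.quotient hx hx2)
    have hp := (Ideal.Quotient.isDomain_iff_prime _).mp this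
    obtain ⟨q, hq, hqx⟩ :=
      Ideal.exists_minimalPrimes_le (bot_le : (⊥ : Ideal R) ≤ Ideal.span {x})
    have : q.IsPrime := hq.1.1
    have hbot := eq_bot_of_le_span_singleton_of_notMem hx hqx (hxP q hq)
    subst hbot
    exact IsDomain.of_bot_isPrime R

theorem IsRegularOfDim.isPrime_span_singleton {d : ℕ} {R : Type u} [CommRing R] [IsLocalRing R]
    [IsNoetherianRing R] (h : IsRegularOfDim (d + 1) R) {x : R} (hx : x ∈ maximalIdeal R)
    (hx2 : x ∉ maximalIdeal R ^ 2) : (Ideal.span {x}).IsPrime := by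
  have := isLocalRing_quotient_span hx
  exact (Ideal.Quotient.isDomain_iff_prime _).mp (h.quotient hx hx2).isDomain

theorem IsRegularOfDim.not_le_span_singleton {d : ℕ} {R : Type u} [CommRing R] [IsLocalRing R]
    [IsNoetherianRing R] (h : IsRegularOfDim (d + 2) R) {x : R} (hx : x ∈ maximalIdeal R)
    (hx2 : x ∉ maximalIdeal R ^ 2) : ¬ maximalIdeal R ≤ Ideal.span {x} := by
  intro hle
  have := isLocalRing_quotient_span hx
  refine (h.quotient hx hx2).ringKrullDim_ne_zero (ringKrullDim_eq_zero_of_isField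
    (isField_iff_maximalIdeal_eq.mpr ?_))
  rw [← map_maximalIdeal_of_surjective (Ideal.Quotient.mk (Ideal.span {x}))
    Ideal.Quotient.mk_surjective, Ideal.map_eq_bot_iff_le_ker, Ideal.mk_ker]
  exact hle

theorem hasPositiveDepth_span_singleton {R : Type*} [CommRing R] [IsDomain R] [IsLocalRing R]
    {y : R} (hy0 : y ≠ 0) (hp : (Ideal.span {y}).IsPrime) (hy : y ∈ maximalIdeal R)
    (hlt : ¬ maximalIdeal R ≤ Ideal.span {y}) {c : R} (hc : c ≠ 0) :
    HasPositiveDepth (Ideal.span {c}) := by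
  intro z hz
  simp only [Ideal.mem_span_singleton] at hz ⊢
  obtain ⟨x, hx, hxy⟩ := SetLike.not_le_iff_exists.mp hlt
  have hprime (s t : R) (hst : y ∣ s * t) : y ∣ s ∨ y ∣ t := by
    simpa only [Ideal.mem_span_singleton] using
      hp.mem_or_mem (Ideal.mem_span_singleton.mpr hst)
  rw [Ideal.mem_span_singleton] at hxy
  obtain ⟨v, hv⟩ := hz y hy
  rcases hprime c v ⟨z, hv.symm⟩ with ⟨c', rfl⟩ | ⟨v', rfl⟩
  · have hzv : z = c' * v := mul_left_cancel₀ hy0 (by linear_combination hv)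
    obtain ⟨w, hw⟩ := hz x hx
    have hxv : x * v = y * w :=
      mul_left_cancel₀ (right_ne_zero_of_mul hc) (by rw [hzv] at hw; linear_combination hw)
    obtain ⟨v', rfl⟩ := (hprime x v ⟨w, hxv⟩).resolve_left hxy
    exact ⟨v', by rw [hzv]; ring⟩
  · exact ⟨v', mul_left_cancel₀ hy0 (by linear_combination hv)⟩

theorem IsRegularOfDim.hasPositiveDepth {d : ℕ} {R : Type u} [CommRing R] [IsLocalRing R]
    [IsNoetherianRing R] (h : IsRegularOfDim (d + 2) R) {c : R} (hc : c ≠ 0) :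
    HasPositiveDepth (Ideal.span {c}) := by
  have := h.isDomain
  obtain ⟨y, hy, hy2⟩ := SetLike.not_le_iff_exists.mp h.not_le_sq
  exact hasPositiveDepth_span_singleton
    (ne_of_mem_of_not_mem (zero_mem (maximalIdeal R ^ 2)) hy2).symm
    (h.isPrime_span_singleton hy hy2) hy
    (h.not_le_span_singleton hy hy2) hc

theorem mk_dvd_mk_iff {R : Type*} [CommRing R] {x c z : R} :
    Ideal.Quotient.mk (Ideal.span {x}) c ∣ Ideal.Quotient.mk (Ideal.span {x}) z ↔
      z ∈ Ideal.span {c, x} := by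
  rw [Ideal.mem_span_pair]
  constructor
  · rintro ⟨r, hr⟩
    obtain ⟨r, rfl⟩ := Ideal.Quotient.mk_surjective r
    rw [← map_mul, Ideal.Quotient.eq, Ideal.mem_span_singleton] at hr
    obtain ⟨w, hw⟩ := hr
    exact ⟨r, w, by linear_combination -hw⟩
  · rintro ⟨r, w, rfl⟩
    refine ⟨Ideal.Quotient.mk _ r, ?_⟩
    rw [← map_mul, Ideal.Quotient.eq, Ideal.mem_span_singleton]
    exact ⟨w, by ring⟩

theorem IsRegularOfDim.hasPositiveDepth_pair {d : ℕ} {R : Type u} [CommRing R] [IsLocalRing R]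
    [IsNoetherianRing R] (h : IsRegularOfDim (d + 3) R) {c x : R} (hx : x ∈ maximalIdeal R)
    (hx2 : x ∉ maximalIdeal R ^ 2) (hc : ¬ x ∣ c) : HasPositiveDepth (Ideal.span {c, x}) := by
  have := isLocalRing_quotient_span hx
  intro z hz
  rw [← mk_dvd_mk_iff, ← Ideal.mem_span_singleton]
  refine (h.quotient hx hx2).hasPositiveDepth
    (by rwa [Ne, Ideal.Quotient.eq_zero_iff_mem, Ideal.mem_span_singleton]) _ fun y hy ↦ ?_
  rw [← map_maximalIdeal_of_surjective (Ideal.Quotient.mk (Ideal.span {x}))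
    Ideal.Quotient.mk_surjective] at hy
  obtain ⟨y, hym, rfl⟩ := (Ideal.mem_map_iff_of_surjective _ Ideal.Quotient.mk_surjective).mp hy
  rw [← map_mul, Ideal.mem_span_singleton, mk_dvd_mk_iff]
  exact hz y hym

theorem mem_span_pair_mul {R : Type*} [CommRing R] {a c p x : R}
    (hxp : ∀ r, x * r ∈ Ideal.span {c, p} → r ∈ Ideal.span {c, p})
    (hap : a ∈ Ideal.span {c, p}) (hax : a ∈ Ideal.span {c, x}) :
    a ∈ Ideal.span {c, p * x} := by
  obtain ⟨v, w, rfl⟩ := Ideal.mem_span_pair.mp hax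
  have hxw : x * w ∈ Ideal.span {c, p} := by
    have : x * w = v * c + w * x - v * c := by ring
    rw [this]
    exact sub_mem hap (Ideal.mul_mem_left _ _ (Ideal.subset_span (by simp)))
  obtain ⟨r, s, rfl⟩ := Ideal.mem_span_pair.mp (hxp w hxw)
  exact Ideal.mem_span_pair.mpr ⟨v + r * x, s, by ring⟩

theorem HasPositiveDepth.mul {R : Type*} [CommRing R] [IsLocalRing R] {c p x : R}
    (hp : HasPositiveDepth (Ideal.span {c, p})) (hcx : HasPositiveDepth (Ideal.span {c, x}))
    (hxc : ∀ r, x * r ∈ Ideal.span {c} → r ∈ Ideal.span {c}) :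
    HasPositiveDepth (Ideal.span {c, p * x}) := by
  intro z hz
  obtain ⟨z₀, z₁, rfl⟩ := Ideal.mem_span_pair.mp <| hcx z fun y hy ↦ by
    obtain ⟨r, s, hrs⟩ := Ideal.mem_span_pair.mp (hz y hy)
    exact Ideal.mem_span_pair.mpr ⟨r, s * p, by linear_combination hrs⟩
  obtain ⟨r, s, hrs⟩ := Ideal.mem_span_pair.mp <| hp z₁ fun y hy ↦ by
    obtain ⟨r, s, hrs⟩ := Ideal.mem_span_pair.mp (hz y hy)
    obtain ⟨t, ht⟩ := Ideal.mem_span_singleton'.mp <| hxc (y * z₁ - s * p)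
      (Ideal.mem_span_singleton'.mpr ⟨r - y * z₀, by linear_combination hrs⟩)
    exact Ideal.mem_span_pair.mpr ⟨t, s, by linear_combination ht⟩
  exact Ideal.mem_span_pair.mpr ⟨z₀ + r * x, s, by linear_combination x * hrs⟩

theorem exists_notMem_sup_maximalIdeal_pow {R : Type*} [CommRing R] [IsLocalRing R]
    [IsNoetherianRing R] {a c : R} (h : ¬ c ∣ a) :
    ∃ N, ∀ n ≥ N, ∀ p ∈ maximalIdeal R ^ n, a ∉ Ideal.span {c, p} := by
  by_contra! hcon
  have hc : c ∈ maximalIdeal R := fun hu ↦ h hu.dvd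
  have := isLocalRing_quotient_span hc
  have hbot := Ideal.iInf_pow_eq_bot_of_isLocalRing (maximalIdeal (R ⧸ Ideal.span {c}))
    (maximalIdeal.isMaximal _).ne_top
  refine h ?_
  rw [← Ideal.mem_span_singleton, ← Ideal.Quotient.eq_zero_iff_mem, ← Ideal.mem_bot, ← hbot,
    Ideal.mem_iInf]
  intro N
  obtain ⟨n, hn, p, hp, ha⟩ := hcon N
  obtain ⟨r, s, rfl⟩ := Ideal.mem_span_pair.mp ha
  rw [map_add, map_mul, Ideal.Quotient.eq_zero_iff_mem.mpr (Ideal.mem_span_singleton_self c),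
    mul_zero, zero_add, map_mul]
  refine Ideal.mul_mem_left _ _ (Ideal.pow_le_pow_right hn ?_)
  rw [← map_maximalIdeal_of_surjective (Ideal.Quotient.mk (Ideal.span {c}))
    Ideal.Quotient.mk_surjective, ← Ideal.map_pow]
  exact Ideal.mem_map_of_mem _ hp

/-- Divisibility of one of two elements by the other can be tested modulo regular parameters. -/
theorem IsRegularOfDim.dvd_or_dvd_of_forall_mem {d : ℕ} {R : Type u} [CommRing R] [IsLocalRing R]
    [IsNoetherianRing R] (h : IsRegularOfDim (d + 3) R) {a c : R}
    (hac : ∀ x ∈ maximalIdeal R, x ∉ maximalIdeal R ^ 2 →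
      a ∈ Ideal.span {c, x} ∨ c ∈ Ideal.span {a, x}) : c ∣ a ∨ a ∣ c := by
  have := h.isDomain
  by_contra! hcon
  obtain ⟨hca, hac'⟩ := hcon
  have ha0 : a ≠ 0 := by
    rintro rfl
    exact hca (dvd_zero c)
  have hc0 : c ≠ 0 := by
    rintro rfl
    exact hac' (dvd_zero a)
  have hndvd (x : R) (hx : x ∈ maximalIdeal R) (c : R) (hc0 : c ≠ 0)
      (hxc : ∀ r, x * r ∈ Ideal.span {c} → r ∈ Ideal.span {c}) : ¬ x ∣ c := by
    rintro ⟨t, ht⟩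
    obtain ⟨k, rfl⟩ := Ideal.mem_span_singleton.mp
      (hxc t (ht ▸ Ideal.mem_span_singleton_self c))
    refine hx (IsUnit.of_mul_eq_one k (mul_left_cancel₀ hc0 ?_))
    linear_combination -ht
  have key (n : ℕ) : ∃ s t, s + t = n ∧ ∃ p ∈ maximalIdeal R ^ s, ∃ q ∈ maximalIdeal R ^ t,
      a ∈ Ideal.span {c, p} ∧ c ∈ Ideal.span {a, q} ∧
        HasPositiveDepth (Ideal.span {c, p}) ∧ HasPositiveDepth (Ideal.span {a, q}) := by
    induction n with
    | zero =>
      have htop (c : R) : Ideal.span {c, 1} = ⊤ :=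
        (Ideal.eq_top_iff_one _).mpr (Ideal.subset_span (by simp))
      exact ⟨0, 0, rfl, 1, by simp, 1, by simp, by simp [htop], by simp [htop],
        fun _ _ ↦ by simp [htop], fun _ _ ↦ by simp [htop]⟩
    | succ n ih =>
      obtain ⟨s, t, rfl, p, hp, q, hq, hap, hcq, hcpd, haqd⟩ := ih
      obtain ⟨x, hx, hx2, hreg⟩ := exists_regular_mem_maximalIdeal h.not_le_sq
        (L := {Ideal.span {c}, Ideal.span {a}, Ideal.span {c, p}, Ideal.span {a, q}})
        (by simp) (by
          rintro J (rfl | rfl | rfl | rfl)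
          exacts [h.hasPositiveDepth hc0, h.hasPositiveDepth ha0, hcpd, haqd])
      have hxc := hreg (Ideal.span {c}) (by simp)
      have hxa := hreg (Ideal.span {a}) (by simp)
      rcases hac x hx hx2 with hax | hcx
      · exact ⟨s + 1, t, by omega, p * x, pow_succ (maximalIdeal R) s ▸ Ideal.mul_mem_mul hp hx,
          q, hq, mem_span_pair_mul (hreg _ (by simp)) hap hax, hcq,
          hcpd.mul (h.hasPositiveDepth_pair hx hx2 (hndvd x hx c hc0 hxc)) hxc, haqd⟩
      · exact ⟨s, t + 1, by omega, p, hp, q * x,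
          pow_succ (maximalIdeal R) t ▸ Ideal.mul_mem_mul hq hx, hap,
          mem_span_pair_mul (hreg _ (by simp)) hcq hcx, hcpd,
          haqd.mul (h.hasPositiveDepth_pair hx hx2 (hndvd x hx a ha0 hxa)) hxa⟩
  obtain ⟨N₁, hN₁⟩ := exists_notMem_sup_maximalIdeal_pow hca
  obtain ⟨N₂, hN₂⟩ := exists_notMem_sup_maximalIdeal_pow hac'
  obtain ⟨s, t, hst, p, hp, q, hq, hap, hcq, -, -⟩ := key (N₁ + N₂)
  rcases le_or_gt N₁ s with hs | hs
  · exact hN₁ s hs p hp hap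
  · exact hN₂ t (by omega) q hq hcq

theorem IsRegularOfDim.isRegularSurface {R : Type u} [CommRing R] [IsLocalRing R]
    [IsNoetherianRing R] (h : IsRegularOfDim 2 R) : IsRegularSurface R := by
  have := h.isDomain
  obtain ⟨x, hx, hx2⟩ := SetLike.not_le_iff_exists.mp h.not_le_sq
  have hp := h.isPrime_span_singleton hx hx2
  have hnle := h.not_le_span_singleton hx hx2
  have := isLocalRing_quotient_span hx
  obtain ⟨⟨s, hs, hcard⟩, -⟩ := h.quotient hx hx2
  obtain ⟨y, hy⟩ : ∃ y, Ideal.span {y} = maximalIdeal (R ⧸ Ideal.span {x}) := by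
    rcases Finset.card_le_one_iff_subset_singleton.mp hcard with ⟨y, hy⟩
    rcases Finset.subset_singleton_iff.mp hy with rfl | rfl
    · exact ⟨0, by simpa using hs⟩
    · exact ⟨y, by simpa using hs⟩
  obtain ⟨y, rfl⟩ := Ideal.Quotient.mk_surjective y
  have hm : Ideal.span {x, y} = maximalIdeal R := by
    ext z
    rw [Set.pair_comm, ← mk_dvd_mk_iff, ← Ideal.mem_span_singleton, hy,
      ← map_maximalIdeal_of_surjective (Ideal.Quotient.mk (Ideal.span {x}))
      Ideal.Quotient.mk_surjective, Ideal.mem_map_iff_of_surjective _ Ideal.Quotient.mk_surjective]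
    refine ⟨fun ⟨w, hw, hwz⟩ ↦ ?_, fun hz ↦ ⟨z, hz, rfl⟩⟩
    have := (Ideal.span_singleton_le_iff_mem _).mpr hx (Ideal.Quotient.eq.mp hwz)
    simpa using sub_mem hw this
  refine ⟨x, y, hm, fun r hr ↦ ?_, fun r hr ↦ ?_⟩
  · rw [zero_dvd_iff] at hr ⊢
    refine (mul_eq_zero.mp hr).resolve_left ?_
    rintro rfl
    exact hx2 (zero_mem _)
  · rw [← Ideal.mem_span_singleton] at hr ⊢
    refine (hp.mem_or_mem hr).resolve_left fun hyx ↦ hnle ?_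
    rw [← hm, Ideal.span_le]
    rintro _ (rfl | rfl)
    exacts [Ideal.mem_span_singleton_self _, hyx]

theorem IsRegularOfDim.dvd_or_dvd_of_cube_add_cube_eq_cube {d : ℕ} {R : Type u} [CommRing R]
    [IsLocalRing R] [IsNoetherianRing R] (h : IsRegularOfDim (d + 2) R) (h3 : IsUnit (3 : R))
    {a b c : R} (habc : c ^ 3 + a ^ 3 = b ^ 3) : c ∣ a ∨ a ∣ c := by
  induction d generalizing R with
  | zero => exact h.isRegularSurface.dvd_or_dvd_of_cube_add_cube_eq_cube h3 habc
  | succ d ih =>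
    refine h.dvd_or_dvd_of_forall_mem fun x hx hx2 ↦ ?_
    have := isLocalRing_quotient_span hx
    rw [← mk_dvd_mk_iff, ← mk_dvd_mk_iff]
    exact ih (h.quotient hx hx2) (isUnit_three_map (Ideal.Quotient.mk _) h3)
      (b := Ideal.Quotient.mk _ b)
      (by simpa using congrArg (Ideal.Quotient.mk (Ideal.span {x})) habc)

/-- STATEMENT 6: If `R` is a Henselian regular local ring of dimension `≥ 2` with residue
characteristic `= 2` and fraction field `K`, and `α, β ∈ K` satisfy `1 + α³ = β³`,
then `α ∈ R` or `1/α ∈ R`. -/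
theorem stmt8 (R K : Type*) [CommRing R] [IsDomain R] [HenselianLocalRing R]
    (hreg : IsRegularLocal R) (hdim : 2 ≤ ringKrullDim R)
    (hchar : ringChar (IsLocalRing.ResidueField R) = 2)
    [Field K] [Algebra R K] [IsFractionRing R K]
    (α β : K) (h : 1 + α ^ 3 = β ^ 3) :
    (∃ r : R, α = algebraMap R K r) ∨ (∃ r : R, α⁻¹ = algebraMap R K r) := by
  obtain ⟨_, s, hs, hcard⟩ := hreg
  obtain ⟨d, hd⟩ : ∃ d, s.card = d + 2 := by
    rw [← hcard] at hdim
    exact Nat.exists_eq_add_of_le' (Nat.cast_le (α := WithBot ℕ∞).mp hdim)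
  have hR : IsRegularOfDim (d + 2) R := ⟨⟨s, hs, hd.le⟩, hd ▸ hcard.le⟩
  have h3 : IsUnit (3 : R) := by
    rw [← residue_ne_zero_iff_isUnit, map_ofNat]
    have h2 : (2 : ResidueField R) = 0 := by
      have := ringChar.Nat.cast_ringChar (R := ResidueField R)
      rwa [hchar] at this
    intro h0
    exact one_ne_zero (α := ResidueField R) (by linear_combination h0 - h2)
  obtain ⟨⟨c, hc⟩, hint⟩ := IsLocalization.exist_integer_multiples_of_finite
    (nonZeroDivisors R) ![α, β]
  obtain ⟨a, ha⟩ := hint 0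
  obtain ⟨b, hb⟩ := hint 1
  simp only [Algebra.smul_def, Matrix.cons_val_zero, Matrix.cons_val_one] at ha hb
  have hc0 : algebraMap R K c ≠ 0 := IsFractionRing.to_map_ne_zero_of_mem_nonZeroDivisors hc
  have habc : c ^ 3 + a ^ 3 = b ^ 3 := by
    apply IsFractionRing.injective R K
    simp only [map_add, map_pow, ha, hb]
    linear_combination algebraMap R K c ^ 3 * h
  rcases hR.dvd_or_dvd_of_cube_add_cube_eq_cube h3 habc with ⟨r, rfl⟩ | ⟨r, rfl⟩
  · left
    rw [map_mul] at ha
    exact ⟨r, (mul_left_cancel₀ hc0 ha).symm⟩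
  · right
    refine ⟨r, inv_eq_of_mul_eq_one_right (mul_left_cancel₀ hc0 ?_)⟩
    rw [map_mul] at ha ⊢
    linear_combination (-algebraMap R K r) * ha
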